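/- arXiv:1904.09237 — 2 statements merged into one kernel-verified Lean document; each statement's English description precedes it below -/
import Mathlib

section
/- There exists an online convex optimization problem on the domain F = [-1,1] with linear losses bounded gradients, namely f_t(x) = Cx when t mod 3 = 1 and f_t(x) = -x otherwise with C ≥ 2, on which the Adam algorithm with β_1 = 0, β_2 = 1/(1+C^2), and step sizes α_t = α/√t with 0 < α < sqrt(1-β_2), initialized at x_1 = 1, satisfies x_{3t+1} = 1 and x_t > 0 for all t, and hence incurs regret R_T ≥ (2C-4)T/3, so R_T/T does not converge to 0. -/
open Filter

/-- The tangent line of `1 / √s` at `s = 4` lies below the graph. -/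
lemma tangent_le_one_div_sqrt {s : ℝ} (hs : 0 < s) : 3 / 4 - s / 16 ≤ 1 / √s := by
  have hr : 0 < √s := Real.sqrt_pos.mpr hs
  rw [le_div_iff₀ hr]
  have h := Real.sq_sqrt hs.le
  nlinarith [mul_nonneg (sq_nonneg (√s - 2)) (by linarith : (0 : ℝ) ≤ √s + 4)]

lemma one_div_sqrt_le_add {a p q : ℝ} (ha : 0 < a) (hp : 0 < p) (hq : 0 < q)
    (h : p + q ≤ 8 * a) : 1 / √a ≤ 1 / √p + 1 / √q := by
  have key : ∀ r, 0 < r → 1 / √a * (3 / 4 - r / a / 16) ≤ 1 / √r := by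
    intro r hr
    have h1 := mul_le_mul_of_nonneg_left (tangent_le_one_div_sqrt (div_pos hr ha))
      (by positivity : 0 ≤ 1 / √a)
    have h2 : 1 / √a * (1 / √(r / a)) = 1 / √r := by
      rw [one_div_mul_one_div, ← Real.sqrt_mul ha.le, mul_div_cancel₀ _ ha.ne']
    linarith
  have hs : p / a + q / a ≤ 8 := by
    rw [← add_div, div_le_iff₀ ha]
    exact h
  have hm := mul_le_mul_of_nonneg_left hs (by positivity : 0 ≤ 1 / √a)
  linarith [key p hp, key q hq]

/-- One period of the weights `v`: the sum of the two upward steps dominates the downward step. -/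
lemma period_step_bound {b C t u : ℝ} (hC : 2 ≤ C) (hb : b * (1 + C ^ 2) = 1) (ht : 1 ≤ t)
    (hu : (1 - b) * C ^ 2 ≤ u) (huC : 2 ≤ t ∧ u ≤ C ^ 2 ∨ u ≤ (1 - b) * C ^ 2) :
    C / (√t * √u) ≤ 1 / (√t * √(1 - b)) ∧
    1 / (√t * √(1 - b)) ≤ 1 / (√(t + 1) * √(b * u + (1 - b))) +
      1 / (√(t + 2) * √(b * (b * u + (1 - b)) + (1 - b))) := by
  have hC2 : 4 ≤ C ^ 2 := by nlinarith
  have hb0 : 0 < b := by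
    by_contra! h
    nlinarith
  have hb5 : b ≤ 1 / 5 := by nlinarith
  have hw : 0 < 1 - b := by linarith
  have ht0 : 0 < t := by linarith
  have hu0 : 0 < u := lt_of_lt_of_le (by positivity) hu
  have hv1 : 0 < b * u + (1 - b) := by positivity
  have hv2 : 0 < b * (b * u + (1 - b)) + (1 - b) := by positivity
  constructor
  · have h : √(1 - b) * C ≤ √u := by
      rw [← Real.sqrt_sq (by linarith : 0 ≤ C), ← Real.sqrt_mul hw.le]
      exact Real.sqrt_le_sqrt hu
    have hsu : 0 < √u := Real.sqrt_pos.mpr hu0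
    have hsw : 0 < √(1 - b) := Real.sqrt_pos.mpr hw
    have hst : 0 < √t := Real.sqrt_pos.mpr ht0
    rw [div_le_div_iff₀ (by positivity) (by positivity)]
    nlinarith
  · rw [← Real.sqrt_mul ht0.le, ← Real.sqrt_mul (by linarith), ← Real.sqrt_mul (by linarith)]
    refine one_div_sqrt_le_add (by positivity) (by positivity) (by positivity) ?_
    rcases huC with ⟨ht2, h⟩ | h
    · have h1 : b * u + (1 - b) ≤ 2 * (1 - b) := by nlinarith
      have h2 : b * (b * u + (1 - b)) + (1 - b) ≤ 7 / 5 * (1 - b) := by nlinarith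
      have h3 := mul_le_mul_of_nonneg_left h1 (by linarith : 0 ≤ t + 1)
      have h4 := mul_le_mul_of_nonneg_left h2 (by linarith : 0 ≤ t + 2)
      nlinarith
    · have hueq : b * u = (1 - b) * (1 - b) := by
        have : u = (1 - b) * C ^ 2 := le_antisymm h hu
        rw [this]
        linear_combination (1 - b) * hb
      rw [hueq]
      have h1 : (2 - b) + (1 + b * (2 - b)) ≤ 4 := by nlinarith
      have h2 : 2 * (2 - b) + 3 * (1 + b * (2 - b)) ≤ 8 := by
        nlinarith [mul_nonneg hw.le (by linarith : 0 ≤ 1 - 3 * b)]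
      have h3 : (t + 1) * (2 - b) + (t + 2) * (1 + b * (2 - b)) ≤ 8 * t := by nlinarith
      nlinarith

/-- Non-convergence of Adam (Theorem 1): on `F = [-1,1]` with losses `f_t(x) = Cx` if
`t mod 3 = 1` and `-x` otherwise (`C ≥ 2`), Adam with `β₁ = 0`, `β₂ = 1/(1+C²)`,
`α_t = α/√t` (`0 < α < √(1-β₂)`) started at `x₁ = 1` keeps `x_{3t+1} = 1`, all iterates
positive, incurs regret `R_T ≥ (2C-4)T/3`, and (for `C > 2`) `R_T/T` does not tend to `0`. -/
theorem stmt_8 (C α β₂ : ℝ) (hC : 2 ≤ C) (hβ₂ : β₂ = 1 / (1 + C ^ 2))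
    (hα : 0 < α) (hα' : α < Real.sqrt (1 - β₂))
    (f : ℕ → ℝ → ℝ) (hf : ∀ t z, f t z = if t % 3 = 1 then C * z else -z)
    (g : ℕ → ℝ) (hg : ∀ t, g t = if t % 3 = 1 then C else -1)
    (v : ℕ → ℝ) (hv0 : v 0 = 0)
    (hv : ∀ t : ℕ, 1 ≤ t → v t = β₂ * v (t - 1) + (1 - β₂) * g t ^ 2)
    (x : ℕ → ℝ) (hx1 : x 1 = 1)
    (hx : ∀ t : ℕ, 1 ≤ t →
      x (t + 1) = max (-1) (min 1 (x t - (α / Real.sqrt t) * g t / Real.sqrt (v t)))) :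
    (∀ t : ℕ, x (3 * t + 1) = 1) ∧
    (∀ t : ℕ, 1 ≤ t → 0 < x t) ∧
    (∀ T : ℕ, 1 ≤ T →
      ∑ t ∈ Finset.Icc 1 T, f t (x t) -
          sInf ((fun y => ∑ t ∈ Finset.Icc 1 T, f t y) '' Set.Icc (-1 : ℝ) 1) ≥
        (2 * C - 4) * T / 3) ∧
    (2 < C → ¬ Tendsto
      (fun T : ℕ => (∑ t ∈ Finset.Icc 1 T, f t (x t) -
        sInf ((fun y => ∑ t ∈ Finset.Icc 1 T, f t y) '' Set.Icc (-1 : ℝ) 1)) / T)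
      atTop (nhds 0)) := by
  have hb : β₂ * (1 + C ^ 2) = 1 := by
    rw [hβ₂]
    field_simp
  have hC2 : 4 ≤ C ^ 2 := by nlinarith
  have hb0 : 0 < β₂ := by
    rw [hβ₂]
    positivity
  have hb5 : β₂ ≤ 1 / 5 := by nlinarith
  have hw : 0 < 1 - β₂ := by linarith
  have hvb : ∀ t, 0 ≤ v t ∧ v t ≤ C ^ 2 := by
    intro t
    induction t with
    | zero => exact ⟨hv0.ge, by rw [hv0]; positivity⟩
    | succ n ih =>
      have hg2 : g (n + 1) ^ 2 ≤ C ^ 2 := by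
        rw [hg]
        split_ifs <;> nlinarith
      rw [hv (n + 1) (by omega), Nat.add_sub_cancel]
      have := ih.1
      exact ⟨by positivity, by nlinarith [ih.2]⟩
  have hxle : ∀ t, 1 ≤ t → x t ≤ 1 := by
    intro t ht
    obtain ⟨n, rfl⟩ := Nat.exists_eq_add_of_le' ht
    rcases Nat.eq_zero_or_pos n with rfl | hn
    · exact hx1.le
    · rw [hx n hn]
      exact max_le (by norm_num) (min_le_left _ _)
  have hperiod : ∀ k, x (3 * k + 1) = 1 →
      0 < x (3 * k + 2) ∧ 0 < x (3 * k + 3) ∧ x (3 * k + 4) = 1 := by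
    intro k hk
    have g1 : g (3 * k + 1) = C := by rw [hg, if_pos (by omega)]
    have g2 : g (3 * k + 2) = -1 := by rw [hg, if_neg (by omega)]
    have g3 : g (3 * k + 3) = -1 := by rw [hg, if_neg (by omega)]
    have v1 : v (3 * k + 1) = β₂ * v (3 * k) + (1 - β₂) * C ^ 2 := by
      rw [hv _ (by omega), g1]; rfl
    have v2 : v (3 * k + 2) = β₂ * v (3 * k + 1) + (1 - β₂) := by
      rw [hv _ (by omega), g2]; norm_num
    have v3 : v (3 * k + 3) = β₂ * (β₂ * v (3 * k + 1) + (1 - β₂)) + (1 - β₂) := by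
      rw [hv _ (by omega), g3, ← v2]; norm_num
    set t : ℝ := 3 * k + 1 with ht
    have ht1 : 1 ≤ t := by
      have : (0 : ℝ) ≤ k := k.cast_nonneg
      linarith
    have x2 := hx (3 * k + 1) (by omega)
    have x3 := hx (3 * k + 2) (by omega)
    have x4 := hx (3 * k + 3) (by omega)
    have c1 : ((3 * k + 1 : ℕ) : ℝ) = t := by push_cast; rfl
    have c2 : ((3 * k + 2 : ℕ) : ℝ) = t + 1 := by push_cast; rw [ht]; ring
    have c3 : ((3 * k + 3 : ℕ) : ℝ) = t + 2 := by push_cast; rw [ht]; ring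
    rw [g1, c1, hk] at x2
    rw [g2, c2, v2] at x3
    rw [g3, c3, v3] at x4
    have hu : (1 - β₂) * C ^ 2 ≤ v (3 * k + 1) := by
      rw [v1]
      have := mul_nonneg hb0.le (hvb (3 * k)).1
      linarith
    have huC : 2 ≤ t ∧ v (3 * k + 1) ≤ C ^ 2 ∨ v (3 * k + 1) ≤ (1 - β₂) * C ^ 2 := by
      rcases Nat.eq_zero_or_pos k with h0 | h0
      · right
        rw [v1, h0, hv0, mul_zero, zero_add]
      · left
        have : (1 : ℝ) ≤ k := by exact_mod_cast h0
        exact ⟨by linarith, (hvb _).2⟩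
    obtain ⟨hdown, hup⟩ := period_step_bound hC hb ht1 hu huC
    have hdown' := mul_le_mul_of_nonneg_left hdown hα.le
    have hup' := mul_le_mul_of_nonneg_left hup hα.le
    have hlt : α * (1 / (√t * √(1 - β₂))) < 1 := by
      have h1 : 1 ≤ √t := Real.one_le_sqrt.mpr ht1
      have h2 : 0 < √(1 - β₂) := Real.sqrt_pos.mpr hw
      rw [mul_one_div, div_lt_one (by positivity)]
      nlinarith
    have e1 : α / √t * C / √(v (3 * k + 1)) = α * (C / (√t * √(v (3 * k + 1)))) := by
      rw [div_mul_eq_mul_div, div_div, mul_div_assoc]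
    have e2 : ∀ p q : ℝ, α / p * (-1) / q = -(α * (1 / (p * q))) := by
      intro p q
      rw [div_mul_eq_mul_div, div_div, mul_div_assoc, neg_div, mul_neg]
    rw [e1] at x2
    rw [e2, sub_neg_eq_add] at x3 x4
    have p1 : 0 ≤ α * (C / (√t * √(v (3 * k + 1)))) := by positivity
    have p2 : 0 ≤ α * (1 / (√(t + 1) * √(β₂ * v (3 * k + 1) + (1 - β₂)))) := by positivity
    have p3 : 0 ≤ α * (1 / (√(t + 2) *
        √(β₂ * (β₂ * v (3 * k + 1) + (1 - β₂)) + (1 - β₂)))) := by positivity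
    rw [mul_add] at hup'
    rw [min_eq_right (by linarith), max_eq_right (by linarith)] at x2
    have q2 : 0 < x (3 * k + 2) := by
      rw [x2]
      linarith
    have q3 : 0 < x (3 * k + 3) := by
      rw [x3]
      exact lt_max_of_lt_right (lt_min one_pos (by linarith))
    refine ⟨q2, q3, ?_⟩
    rw [x4]
    have hge : 1 ≤ x (3 * k + 3) + α * (1 / (√(t + 2) *
        √(β₂ * (β₂ * v (3 * k + 1) + (1 - β₂)) + (1 - β₂)))) := by
      rw [x3]
      rcases le_total 1 (x (3 * k + 2) +
        α * (1 / (√(t + 1) * √(β₂ * v (3 * k + 1) + (1 - β₂))))) with h | h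
      · rw [min_eq_left h, max_eq_right (by norm_num)]
        linarith
      · rw [min_eq_right h, max_eq_right (by linarith)]
        linarith
    rw [min_eq_left hge, max_eq_right (by norm_num)]
  have hone : ∀ k, x (3 * k + 1) = 1 := by
    intro k
    induction k with
    | zero => exact hx1
    | succ n ih => exact (hperiod n ih).2.2
  have hgap : ∀ k : ℕ, (2 * C - 4) * k ≤ ∑ t ∈ Finset.Icc 1 (3 * k), (f t (x t) - f t (-1)) ∧
      (2 * C - 4) * k + 2 * C ≤ ∑ t ∈ Finset.Icc 1 (3 * k + 1), (f t (x t) - f t (-1)) ∧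
      (2 * C - 4) * k + 2 * C - 2 ≤
        ∑ t ∈ Finset.Icc 1 (3 * k + 2), (f t (x t) - f t (-1)) := by
    have hdiff1 : ∀ k, f (3 * k + 1) (x (3 * k + 1)) - f (3 * k + 1) (-1) = 2 * C := by
      intro k
      rw [hf, hf, if_pos (by omega), if_pos (by omega), hone]
      ring
    have hdiff : ∀ t, 1 ≤ t → t % 3 ≠ 1 → -2 ≤ f t (x t) - f t (-1) := by
      intro t ht h
      rw [hf, hf, if_neg h, if_neg h]
      linarith [hxle t ht]
    have hstep : ∀ k : ℕ,
        (2 * C - 4) * k ≤ ∑ t ∈ Finset.Icc 1 (3 * k), (f t (x t) - f t (-1)) →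
        (2 * C - 4) * k + 2 * C ≤ ∑ t ∈ Finset.Icc 1 (3 * k + 1), (f t (x t) - f t (-1)) ∧
        (2 * C - 4) * k + 2 * C - 2 ≤
          ∑ t ∈ Finset.Icc 1 (3 * k + 2), (f t (x t) - f t (-1)) := by
      intro k h
      have h2 := hdiff (3 * k + 2) (by omega) (by omega)
      rw [Finset.sum_Icc_succ_top (by omega : 1 ≤ 3 * k + 1 + 1),
        Finset.sum_Icc_succ_top (by omega : 1 ≤ 3 * k + 1), hdiff1]
      exact ⟨by linarith, by linarith⟩
    intro k
    induction k with
    | zero => exact ⟨by simp, hstep 0 (by simp)⟩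
    | succ n ih =>
      have h3 := hdiff (3 * n + 3) (by omega) (by omega)
      have h : (2 * C - 4) * ((n + 1 : ℕ) : ℝ) ≤
          ∑ t ∈ Finset.Icc 1 (3 * (n + 1)), (f t (x t) - f t (-1)) := by
        rw [show 3 * (n + 1) = 3 * n + 2 + 1 by ring,
          Finset.sum_Icc_succ_top (by omega : 1 ≤ 3 * n + 2 + 1)]
        push_cast
        linarith [ih.2.2]
      exact ⟨h, hstep _ h⟩
  have hregret : ∀ T : ℕ, (2 * C - 4) * T / 3 ≤ ∑ t ∈ Finset.Icc 1 T, f t (x t) -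
      sInf ((fun y => ∑ t ∈ Finset.Icc 1 T, f t y) '' Set.Icc (-1 : ℝ) 1) := by
    intro T
    have hcont : Continuous fun y => ∑ t ∈ Finset.Icc 1 T, f t y := by
      refine continuous_finsetSum _ fun t _ => ?_
      by_cases h : t % 3 = 1
      · simpa only [funext (hf t), if_pos h] using continuous_const_mul C
      · simpa only [funext (hf t), if_neg h] using continuous_neg
    have hinf : sInf ((fun y => ∑ t ∈ Finset.Icc 1 T, f t y) '' Set.Icc (-1 : ℝ) 1) ≤
        ∑ t ∈ Finset.Icc 1 T, f t (-1) :=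
      csInf_le (isCompact_Icc.image hcont).bddBelow ⟨-1, by norm_num, rfl⟩
    have hmain : (2 * C - 4) * T / 3 ≤ ∑ t ∈ Finset.Icc 1 T, (f t (x t) - f t (-1)) := by
      obtain ⟨k, rfl | rfl | rfl⟩ : ∃ k, T = 3 * k ∨ T = 3 * k + 1 ∨ T = 3 * k + 2 :=
        ⟨T / 3, by omega⟩
      all_goals
        push_cast
        linarith [(hgap k).1, (hgap k).2.1, (hgap k).2.2]
    rw [Finset.sum_sub_distrib] at hmain
    linarith
  refine ⟨hone, fun t ht => ?_, fun T _ => hregret T, fun hC' hlim => ?_⟩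
  · obtain ⟨k, rfl | rfl | rfl⟩ : ∃ k, t = 3 * k + 1 ∨ t = 3 * k + 2 ∨ t = 3 * k + 3 :=
      ⟨(t - 1) / 3, by omega⟩
    · rw [hone]
      exact one_pos
    · exact (hperiod k (hone k)).1
    · exact (hperiod k (hone k)).2.1
  · have h : (2 * C - 4) / 3 ≤ 0 := by
      refine ge_of_tendsto hlim ?_
      filter_upwards [eventually_ge_atTop 1] with T hT
      have hT0 : (0 : ℝ) < T := by exact_mod_cast hT
      rw [le_div_iff₀ hT0]
      linarith [hregret T]
    linarith
end

section
/- Under the AMSGrad assumptions (F of bounded L∞-diameter D_∞, gradients bounded by G_∞ in sup-norm, α_t = α/√t, β_{1t} ≤ β_1 < 1, γ = β_1/√β_2 < 1), the AMSGrad algorithm achieves regret R_T ≤ (D_∞^2 √T)/(α(1-β_1)) Σ_{i=1}^d v̂_{T,i}^{1/2} + (D_∞^2/(1-β_1)^2) Σ_{t=1}^T Σ_{i=1}^d β_{1t} v̂_{t,i}^{1/2}/α_t + (α √(1+log T))/((1-β_1)^2(1-γ)√(1-β_2)) Σ_{i=1}^d ||g_{1:T,i}||_2. -/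
open Finset

/-- The discounted sums `∑ j ∈ Icc 1 n, c ^ (n - j) * h j`, in recursive form. -/
noncomputable def discountedSum (c : ℝ) (h : ℕ → ℝ) : ℕ → ℝ
  | 0 => 0
  | n + 1 => c * discountedSum c h n + h (n + 1)

theorem discountedSum_nonneg {c : ℝ} (hc : 0 ≤ c) {h : ℕ → ℝ} (hh : ∀ n, 0 ≤ h n) (n : ℕ) :
    0 ≤ discountedSum c h n := by
  induction n with
  | zero => exact le_rfl
  | succ n ih => exact add_nonneg (mul_nonneg hc ih) (hh _)

theorem sum_discountedSum_div_sqrt_le {c : ℝ} (hc : 0 ≤ c) {h : ℕ → ℝ} (hh : ∀ n, 0 ≤ h n)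
    (n : ℕ) :
    (1 - c) * ∑ t ∈ Icc 1 n, discountedSum c h t / √t + c * (discountedSum c h n / √n) ≤
      ∑ t ∈ Icc 1 n, h t / √t := by
  induction n with
  | zero => simp
  | succ n ih =>
    rw [sum_Icc_succ_top (by omega), sum_Icc_succ_top (by omega)]
    have hstep : discountedSum c h (n + 1) / √((n + 1 : ℕ) : ℝ) ≤
        c * (discountedSum c h n / √n) + h (n + 1) / √((n + 1 : ℕ) : ℝ) := by
      rw [discountedSum, add_div, ← mul_div_assoc]
      rcases Nat.eq_zero_or_pos n with rfl | hn
      · simp [discountedSum]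
      · have := discountedSum_nonneg hc hh n
        gcongr
        simp
    linarith

/-- Cauchy–Schwarz against the harmonic sum. -/
theorem sum_abs_div_sqrt_le (h : ℕ → ℝ) (n : ℕ) :
    ∑ t ∈ Icc 1 n, |h t| / √t ≤ √(1 + Real.log n) * √(∑ t ∈ Icc 1 n, h t ^ 2) := by
  have hcs := Real.sum_mul_le_sqrt_mul_sqrt (Icc 1 n) (fun t : ℕ => (√(t : ℝ))⁻¹) fun t => |h t|
  have hharm : ∑ t ∈ Icc 1 n, ((t : ℝ))⁻¹ ≤ 1 + Real.log n := by
    have := harmonic_le_one_add_log n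
    simpa only [harmonic_eq_sum_Icc, Rat.cast_sum, Rat.cast_inv, Rat.cast_natCast] using this
  simp only [inv_pow, sq_abs, Real.sq_sqrt (Nat.cast_nonneg _)] at hcs
  calc ∑ t ∈ Icc 1 n, |h t| / √t = ∑ t ∈ Icc 1 n, (√(t : ℝ))⁻¹ * |h t| :=
        sum_congr rfl fun t _ => by rw [div_eq_mul_inv, mul_comm]
    _ ≤ _ := hcs
    _ ≤ _ := by gcongr

theorem second_moment_nonneg {β₂ : ℝ} (hβ₂ : 0 ≤ β₂) (hβ₂' : β₂ ≤ 1) {v g : ℕ → ℝ}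
    (hv0 : v 0 = 0) (hv : ∀ n, v (n + 1) = β₂ * v n + (1 - β₂) * g (n + 1) ^ 2) (n : ℕ) :
    0 ≤ v n := by
  induction n with
  | zero => exact hv0.ge
  | succ n ih =>
    rw [hv]
    have := sub_nonneg.2 hβ₂'
    positivity

/-- The square of the first moment is controlled by the root of the second moment, with a factor
that is a geometrically discounted sum of the gradients. -/
theorem first_moment_sq_le {β₁ β₂ : ℝ} (hβ₁' : β₁ < 1) (hβ₂ : 0 < β₂) (hβ₂' : β₂ < 1)
    {b m v g : ℕ → ℝ} (hb : ∀ n, 0 ≤ b n) (hb' : ∀ n, b n ≤ β₁) (hm0 : m 0 = 0) (hv0 : v 0 = 0)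
    (hm : ∀ n, m (n + 1) = b (n + 1) * m n + (1 - b (n + 1)) * g (n + 1))
    (hv : ∀ n, v (n + 1) = β₂ * v n + (1 - β₂) * g (n + 1) ^ 2) (n : ℕ) :
    m n ^ 2 * √(1 - β₂) ≤ discountedSum (β₁ / √β₂) (fun t => |g t|) n * √(v n) := by
  induction n with
  | zero => simp [hm0, hv0]
  | succ n ih =>
    have hvn := second_moment_nonneg hβ₂.le hβ₂'.le hv0 hv n
    have hβ : 0 < 1 - β₂ := sub_pos.2 hβ₂'
    have hb0 := hb (n + 1)
    have hb1 := hb' (n + 1)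
    have hu := discountedSum_nonneg (c := β₁ / √β₂) (h := fun t => |g t|)
      (div_nonneg (hb0.trans hb1) (Real.sqrt_nonneg _)) (fun _ => abs_nonneg _) n
    have hmsq : m (n + 1) ^ 2 ≤ β₁ * m n ^ 2 + g (n + 1) ^ 2 := by
      rw [hm]
      nlinarith [mul_nonneg (mul_nonneg hb0 (by linarith : 0 ≤ 1 - b (n + 1)))
        (sq_nonneg (m n - g (n + 1))), mul_nonneg (sub_nonneg.2 hb1) (sq_nonneg (m n)),
        mul_nonneg hb0 (sq_nonneg (g (n + 1)))]
    have hold : √β₂ * √(v n) ≤ √(v (n + 1)) := by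
      rw [← Real.sqrt_mul hβ₂.le, hv]
      exact Real.sqrt_le_sqrt (le_add_of_nonneg_right (by positivity))
    have hnew : √(1 - β₂) * |g (n + 1)| ≤ √(v (n + 1)) := by
      rw [← Real.sqrt_sq_eq_abs, ← Real.sqrt_mul hβ.le, hv]
      exact Real.sqrt_le_sqrt (le_add_of_nonneg_left (by positivity))
    have hs : 0 < √β₂ := Real.sqrt_pos.2 hβ₂
    calc m (n + 1) ^ 2 * √(1 - β₂)
        ≤ (β₁ * m n ^ 2 + g (n + 1) ^ 2) * √(1 - β₂) := by gcongr
      _ = β₁ * (m n ^ 2 * √(1 - β₂)) + |g (n + 1)| * (√(1 - β₂) * |g (n + 1)|) := by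
        rw [← sq_abs (g (n + 1))]; ring
      _ ≤ β₁ * (discountedSum (β₁ / √β₂) (fun t => |g t|) n * √(v n)) +
          |g (n + 1)| * √(v (n + 1)) := by
        have := hb0.trans hb1
        gcongr
      _ = β₁ / √β₂ * discountedSum (β₁ / √β₂) (fun t => |g t|) n * (√β₂ * √(v n)) +
          |g (n + 1)| * √(v (n + 1)) := by field_simp
      _ ≤ β₁ / √β₂ * discountedSum (β₁ / √β₂) (fun t => |g t|) n * √(v (n + 1)) +
          |g (n + 1)| * √(v (n + 1)) := by
        have := hb0.trans hb1
        gcongr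
      _ = _ := by rw [discountedSum]; ring

/-- A telescoping bound with nondecreasing weights. -/
theorem sum_mul_sub_succ_le {w a : ℕ → ℝ} {B : ℝ} (hw : Monotone w) (hw0 : w 0 = 0) (n : ℕ)
    (ha : ∀ t ∈ Icc 1 n, a t ≤ B) :
    ∑ t ∈ Icc 1 n, w t * (a t - a (t + 1)) ≤ w n * (B - a (n + 1)) := by
  induction n with
  | zero => simp [hw0]
  | succ n ih =>
    rw [sum_Icc_succ_top (by omega)]
    have h1 := ih fun t ht => ha t (Icc_subset_Icc_right n.le_succ ht)
    have h2 := mul_le_mul_of_nonneg_right (hw n.le_succ)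
      (sub_nonneg.2 (ha (n + 1) (by simp)))
    simp only [Nat.succ_eq_add_one] at h2
    linarith

/-- First-order optimality of a weighted projection onto a convex set. -/
theorem weighted_sq_dist_le_of_isMin {ι : Type*} [Fintype ι] {F : Set (EuclideanSpace ℝ ι)}
    (hF : Convex ℝ F) {s : ι → ℝ} (hs : ∀ i, 0 ≤ s i) {c : ι → ℝ} {p y : EuclideanSpace ℝ ι}
    (hp : p ∈ F) (hy : y ∈ F)
    (hmin : ∀ z ∈ F, ∑ i, s i * (p i - c i) ^ 2 ≤ ∑ i, s i * (z i - c i) ^ 2) :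
    ∑ i, s i * (p i - y i) ^ 2 ≤ ∑ i, s i * (c i - y i) ^ 2 := by
  set B := ∑ i, s i * ((p i - c i) * (y i - p i)) with hBdef
  set C := ∑ i, s i * (y i - p i) ^ 2 with hCdef
  have hC : 0 ≤ C := sum_nonneg fun i _ => mul_nonneg (hs i) (sq_nonneg _)
  have hvar : ∀ r : ℝ, 0 ≤ r → r ≤ 1 → 0 ≤ 2 * r * B + r ^ 2 * C := by
    intro r hr hr'
    have h := hmin _ (hF.add_smul_sub_mem hp hy ⟨hr, hr'⟩)
    rw [← sub_nonneg, ← sum_sub_distrib] at h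
    rw [hBdef, hCdef, mul_sum, mul_sum, ← sum_add_distrib]
    refine h.trans_eq (sum_congr rfl fun i _ => ?_)
    simp only [PiLp.add_apply, PiLp.smul_apply, PiLp.sub_apply, smul_eq_mul]
    ring
  have hB : 0 ≤ B := by
    by_contra! hneg
    have hpos : 0 < C - B := by linarith
    have hr : 0 < -B / (C - B) := div_pos (by linarith) hpos
    have hr1 : -B / (C - B) ≤ 1 := (div_le_one hpos).2 (by linarith)
    have h := hvar _ hr.le hr1
    have hrC : -B / (C - B) * (C - B) = -B := div_mul_cancel₀ _ hpos.ne'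
    nlinarith [mul_pos hr hr]
  have hdecomp : ∑ i, s i * (c i - y i) ^ 2 - ∑ i, s i * (p i - y i) ^ 2 =
      ∑ i, s i * (p i - c i) ^ 2 + 2 * B := by
    rw [hBdef, mul_sum, ← sum_sub_distrib, ← sum_add_distrib]
    exact sum_congr rfl fun i _ => by ring
  have : 0 ≤ ∑ i, s i * (p i - c i) ^ 2 := sum_nonneg fun i _ => mul_nonneg (hs i) (sq_nonneg _)
  linarith

/-- The one-step inequality of mirror descent for the diagonal metric `s`. -/
theorem sum_mul_sub_le_of_isMin {ι : Type*} [Fintype ι] {F : Set (EuclideanSpace ℝ ι)}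
    (hF : Convex ℝ F) {s m : ι → ℝ} (hs : ∀ i, 0 ≤ s i) (hsm : ∀ i, s i = 0 → m i = 0) {a : ℝ}
    (ha : 0 < a) {x p y : EuclideanSpace ℝ ι} (hp : p ∈ F) (hy : y ∈ F)
    (hmin : ∀ z ∈ F, ∑ i, s i * (p i - (x i - a * m i / s i)) ^ 2 ≤
      ∑ i, s i * (z i - (x i - a * m i / s i)) ^ 2) :
    ∑ i, m i * (x i - y i) ≤
      ∑ i, (s i / a * ((x i - y i) ^ 2 - (p i - y i) ^ 2) / 2 + a * m i ^ 2 / s i / 2) := by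
  have h := weighted_sq_dist_le_of_isMin hF hs (c := fun i => x i - a * m i / s i) hp hy hmin
  rw [← sub_nonneg, ← sum_sub_distrib] at h ⊢
  have hrw : ∑ i, (s i / a * ((x i - y i) ^ 2 - (p i - y i) ^ 2) / 2 + a * m i ^ 2 / s i / 2 -
      m i * (x i - y i)) =
      1 / (2 * a) * ∑ i, (s i * (x i - a * m i / s i - y i) ^ 2 - s i * (p i - y i) ^ 2) := by
    rw [mul_sum]
    refine sum_congr rfl fun i _ => ?_
    rcases eq_or_ne (s i) 0 with h0 | h0
    · simp [h0, hsm i h0]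
    · field_simp
      ring
  rw [hrw]
  positivity

/-- The gradient inequality for convex functions. -/
theorem ConvexOn.sub_le_inner_of_hasGradientAt {E : Type*} [NormedAddCommGroup E]
    [InnerProductSpace ℝ E] [CompleteSpace E] {F : Set E} {f : E → ℝ} (hf : ConvexOn ℝ F f)
    {x y g : E} (hx : x ∈ F) (hy : y ∈ F) (hg : HasGradientAt f g x) :
    f x - f y ≤ inner ℝ g (x - y) := by
  have hline : HasDerivAt (AffineMap.lineMap x y : ℝ → E) (y - x) 0 :=
    AffineMap.hasDerivAt_lineMap
  have hg' : HasFDerivAt f (InnerProductSpace.toDual ℝ E g)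
      ((AffineMap.lineMap x y : ℝ → E) 0) := by
    simpa using hg.hasFDerivAt
  have hd := hg'.comp_hasDerivAt (0 : ℝ) hline
  have h := (hf.comp_affineMap (AffineMap.lineMap x y : ℝ →ᵃ[ℝ] E)).le_slope_of_hasDerivAt
    (x := 0) (y := 1) (by simpa using hx) (by simpa using hy) one_pos hd
  simp [slope_def_field] at h
  rw [← neg_sub y x, inner_neg_right]
  linarith

/-- Recovering the gradient from two consecutive moments. -/
theorem mul_le_of_first_moment {b m m' g w z B : ℝ} (hb : 0 ≤ b) (hb' : b < 1) (hw : 0 ≤ w)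
    (hm : m = b * m' + (1 - b) * g) (hwm : w = 0 → m' = 0) (hz : z ^ 2 ≤ B) :
    g * z ≤ 1 / (1 - b) * (m * z) + b / (1 - b) * (w * B / 2 + m' ^ 2 / w / 2) := by
  have h1b : 0 < 1 - b := sub_pos.2 hb'
  have hyoung : -(m' * z) ≤ w * B / 2 + m' ^ 2 / w / 2 := by
    rcases hw.eq_or_lt with h0 | h0
    · simp [← h0, hwm h0.symm]
    · have : 0 ≤ (w * z + m') ^ 2 / w / 2 := by positivity
      have heq : (w * z + m') ^ 2 / w / 2 = w * z ^ 2 / 2 + m' * z + m' ^ 2 / w / 2 := by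
        field_simp
        ring
      have := mul_le_mul_of_nonneg_left hz hw
      linarith
  have hg : g * z = 1 / (1 - b) * (m * z) + b / (1 - b) * -(m' * z) := by
    rw [hm]; field_simp; ring
  rw [hg]
  gcongr

theorem reweighted_step_le {b β w A A' B Q Q' : ℝ} (hb : 0 ≤ b) (hbβ : b ≤ β) (hβ : β < 1)
    (hw : 0 ≤ w) (hA : A ≤ B) (hA' : 0 ≤ A') (hB : 0 ≤ B) (hQ : 0 ≤ Q) (hQ' : 0 ≤ Q') :
    1 / (1 - b) * (w * (A - A') / 2 + Q / 2) + b / (1 - b) * (w * B / 2 + Q' / 2) ≤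
      w * (A - A') / 2 + B / (1 - β) * (b * w) + (Q + Q') / (2 * (1 - β)) := by
  have h1 : 0 < 1 - b := by linarith
  have h2 : 0 < 1 - β := by linarith
  have hone : 1 / (1 - b) = 1 + b / (1 - b) := by field_simp; ring
  have hinv : 1 / (1 - b) ≤ 1 / (1 - β) := by gcongr
  have hratio : b / (1 - b) ≤ b / (1 - β) := by gcongr
  have hratio' : b / (1 - b) ≤ 1 / (1 - β) := by gcongr; linarith
  have hwB : b / (1 - b) * (w * (A - A') / 2 + w * B / 2) ≤ b / (1 - β) * (w * B) := by
    have : w * (A - A') ≤ w * B := by gcongr; linarith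
    calc _ ≤ b / (1 - b) * (w * B) := by gcongr; linarith
      _ ≤ _ := by gcongr
  have hq := mul_le_mul_of_nonneg_right hinv hQ
  have hq' := mul_le_mul_of_nonneg_right hratio' hQ'
  have e1 : B / (1 - β) * (b * w) = b / (1 - β) * (w * B) := by ring
  have e2 : (Q + Q') / (2 * (1 - β)) = 1 / (1 - β) * Q / 2 + 1 / (1 - β) * Q' / 2 := by
    field_simp
  rw [e1, e2]
  have e3 : 1 / (1 - b) * (w * (A - A') / 2 + Q / 2) =
    w * (A - A') / 2 + b / (1 - b) * (w * (A - A') / 2) + 1 / (1 - b) * Q / 2 := by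
    linear_combination (w * (A - A') / 2) * hone
  rw [e3]
  linarith

/-- The AMSGrad regret bound (Theorem 4 of Reddi–Kale–Kumar). The feasible set `F` has
`L∞`-diameter at most `D`, gradients are bounded by `G` in sup-norm, `α_t = α/√t`,
`β_{1t} ≤ β₁ < 1` and `γ = β₁/√β₂ < 1`. The regret against any comparator `y ∈ F`
(in particular against the minimizer) is bounded by the stated quantity. -/
theorem stmt_13 (d : ℕ) (F : Set (EuclideanSpace ℝ (Fin d)))
    (hFconv : Convex ℝ F) (hFne : F.Nonempty)
    (D G α β₁ β₂ γ : ℝ) (hD : 0 ≤ D) (hG : 0 ≤ G) (hα : 0 < α)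
    (hdiam : ∀ x ∈ F, ∀ y ∈ F, ∀ i, |x i - y i| ≤ D)
    (hβ₁ : 0 ≤ β₁) (hβ₁' : β₁ < 1) (hβ₂ : 0 < β₂) (hβ₂' : β₂ < 1)
    (hγ : γ = β₁ / Real.sqrt β₂) (hγ' : γ < 1)
    (β1t : ℕ → ℝ) (hβ1t : ∀ t, 0 ≤ β1t t) (hβ1t' : ∀ t, β1t t ≤ β₁)
    (T : ℕ) (hT : 1 ≤ T)
    (f : ℕ → EuclideanSpace ℝ (Fin d) → ℝ) (hconv : ∀ t, ConvexOn ℝ F (f t))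
    (x : ℕ → EuclideanSpace ℝ (Fin d)) (g : ℕ → EuclideanSpace ℝ (Fin d))
    (hx1 : x 1 ∈ F)
    (hgrad : ∀ t ∈ Finset.Icc 1 T, HasGradientAt (f t) (g t) (x t))
    (hgbound : ∀ t ∈ Finset.Icc 1 T, ∀ i, |g t i| ≤ G)
    (m v vhat : ℕ → Fin d → ℝ)
    (hm0 : ∀ i, m 0 i = 0) (hv0 : ∀ i, v 0 i = 0) (hvhat0 : ∀ i, vhat 0 i = 0)
    (hm : ∀ t : ℕ, 1 ≤ t → ∀ i, m t i = β1t t * m (t - 1) i + (1 - β1t t) * g t i)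
    (hv : ∀ t : ℕ, 1 ≤ t → ∀ i, v t i = β₂ * v (t - 1) i + (1 - β₂) * g t i ^ 2)
    (hvhat : ∀ t : ℕ, 1 ≤ t → ∀ i, vhat t i = max (vhat (t - 1) i) (v t i))
    -- `x (t+1)` is the projection, in the `√V̂_t`-weighted norm, of the AMSGrad step
    (hproj : ∀ t ∈ Finset.Icc 1 T, x (t + 1) ∈ F ∧
      ∀ y ∈ F,
        ∑ i, Real.sqrt (vhat t i) *
            (x (t + 1) i - (x t i - (α / Real.sqrt t) * m t i / Real.sqrt (vhat t i))) ^ 2 ≤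
          ∑ i, Real.sqrt (vhat t i) *
            (y i - (x t i - (α / Real.sqrt t) * m t i / Real.sqrt (vhat t i))) ^ 2) :
    ∀ y ∈ F,
      ∑ t ∈ Finset.Icc 1 T, (f t (x t) - f t y) ≤
        D ^ 2 * Real.sqrt T / (α * (1 - β₁)) * ∑ i, Real.sqrt (vhat T i) +
          D ^ 2 / (1 - β₁) ^ 2 *
            ∑ t ∈ Finset.Icc 1 T, ∑ i, β1t t * Real.sqrt (vhat t i) / (α / Real.sqrt t) +
          α * Real.sqrt (1 + Real.log T) /
              ((1 - β₁) ^ 2 * (1 - γ) * Real.sqrt (1 - β₂)) *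
            ∑ i, Real.sqrt (∑ t ∈ Finset.Icc 1 T, g t i ^ 2) := by
  intro y hy
  have hm' : ∀ i n, m (n + 1) i = β1t (n + 1) * m n i + (1 - β1t (n + 1)) * g (n + 1) i :=
    fun i n => by simpa using hm (n + 1) (by omega) i
  have hv' : ∀ i n, v (n + 1) i = β₂ * v n i + (1 - β₂) * g (n + 1) i ^ 2 :=
    fun i n => by simpa using hv (n + 1) (by omega) i
  have hvhat' : ∀ i n, vhat (n + 1) i = max (vhat n i) (v (n + 1) i) :=
    fun i n => by simpa using hvhat (n + 1) (by omega) i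
  have hγ0 : 0 ≤ γ := hγ ▸ div_nonneg hβ₁ (Real.sqrt_nonneg _)
  have h1β₁ : 0 < 1 - β₁ := sub_pos.2 hβ₁'
  have h1γ : 0 < 1 - γ := sub_pos.2 hγ'
  have hσ : 0 < √(1 - β₂) := Real.sqrt_pos.2 (sub_pos.2 hβ₂')
  have hvhat_mono : ∀ i, Monotone fun n => vhat n i := fun i =>
    monotone_nat_of_le_succ fun n => by rw [hvhat']; exact le_max_left _ _
  have hv_le : ∀ i n, v n i ≤ vhat n i := by
    rintro i (_ | n)
    · rw [hv0, hvhat0]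
    · rw [hvhat']; exact le_max_right _ _
  set u : Fin d → ℕ → ℝ := fun i => discountedSum γ fun t => |g t i| with hu
  have hu0 : ∀ i n, 0 ≤ u i n := fun i => discountedSum_nonneg hγ0 fun _ => abs_nonneg _
  have hmoment : ∀ i n, m n i ^ 2 * √(1 - β₂) ≤ u i n * √(vhat n i) := fun i n => by
    have h := first_moment_sq_le (m := fun n => m n i) (v := fun n => v n i)
      (g := fun n => g n i) hβ₁' hβ₂ hβ₂' hβ1t hβ1t' (hm0 i) (hv0 i) (hm' i) (hv' i) n
    rw [← hγ] at h
    exact h.trans (mul_le_mul_of_nonneg_left (Real.sqrt_le_sqrt (hv_le i n)) (hu0 i n))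
  have hm_zero : ∀ i n, √(vhat n i) = 0 → m n i = 0 := fun i n h => by
    have h1 := hmoment i n
    rw [h, mul_zero] at h1
    exact pow_eq_zero_iff two_ne_zero |>.1
      (le_antisymm (nonpos_of_mul_nonpos_left h1 hσ) (sq_nonneg _))
  set w : Fin d → ℕ → ℝ := fun i t => √(vhat t i) / (α / √t) with hw
  have hw0 : ∀ i t, 0 ≤ w i t := fun i t => by positivity
  have hw_mono : ∀ i, Monotone (w i) := fun i s t hst => by
    simp only [hw, ← div_mul]
    have := hvhat_mono i hst
    gcongr
  have hm_zero_of_w : ∀ i n, w i (n + 1) = 0 → m n i = 0 := fun i n h => by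
    refine hm_zero i n (le_antisymm ?_ (Real.sqrt_nonneg _))
    have hα' : α / √((n + 1 : ℕ) : ℝ) ≠ 0 := by positivity
    rw [← (div_eq_zero_iff.1 h).resolve_right hα']
    exact Real.sqrt_le_sqrt (hvhat_mono i n.le_succ)
  set q : Fin d → ℕ → ℝ := fun i t => m t i ^ 2 / w i t with hq
  have hq0 : ∀ i t, 0 ≤ q i t := fun i t => by have := hw0 i t; positivity
  have hqprev : ∀ i n, m n i ^ 2 / w i (n + 1) ≤ q i n := fun i n => by
    rcases (hw0 i n).eq_or_lt with h | h
    · have : m n i = 0 := by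
        rcases Nat.eq_zero_or_pos n with rfl | hn
        · exact hm0 i
        · have hα' : α / √(n : ℝ) ≠ 0 := by positivity
          exact hm_zero i n ((div_eq_zero_iff.1 h.symm).resolve_right hα')
      simp [hq, this]
    · exact div_le_div_of_nonneg_left (sq_nonneg _) h (hw_mono i n.le_succ)
  have hxF : ∀ t ∈ Icc 1 T, x t ∈ F := by
    intro t ht
    obtain ⟨h1, h2⟩ := mem_Icc.1 ht
    rcases h1.eq_or_lt with rfl | h1
    · exact hx1
    · obtain ⟨n, rfl⟩ := Nat.exists_eq_add_of_le' h1.le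
      exact (hproj n (mem_Icc.2 ⟨by omega, by omega⟩)).1
  have hdist : ∀ i, ∀ t ∈ Icc 1 T, (x t i - y i) ^ 2 ≤ D ^ 2 := fun i t ht =>
    sq_le_sq.2 ((hdiam _ (hxF t ht) y hy i).trans (le_abs_self D))
  have hstep : ∀ t ∈ Icc 1 T, f t (x t) - f t y ≤
      ∑ i, (w i t * ((x t i - y i) ^ 2 - (x (t + 1) i - y i) ^ 2) / 2 +
        D ^ 2 / (1 - β₁) * (β1t t * w i t) + (q i t + q i (t - 1)) / (2 * (1 - β₁))) := by
    intro t ht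
    have hb1 : 0 < 1 - β1t t := by linarith [hβ1t' t]
    obtain ⟨n, rfl⟩ := Nat.exists_eq_add_of_le' (mem_Icc.1 ht).1
    have hdescent := sum_mul_sub_le_of_isMin hFconv (fun i => Real.sqrt_nonneg (vhat (n + 1) i))
      (fun i => hm_zero i (n + 1)) (a := α / √((n + 1 : ℕ) : ℝ)) (by positivity)
      (hproj _ ht).1 hy (hproj _ ht).2
    calc f (n + 1) (x (n + 1)) - f (n + 1) y
        ≤ inner ℝ (g (n + 1)) (x (n + 1) - y) :=
          (hconv _).sub_le_inner_of_hasGradientAt (hxF _ ht) hy (hgrad _ ht)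
      _ = ∑ i, g (n + 1) i * (x (n + 1) i - y i) := by
          simp [PiLp.inner_apply, mul_comm]
      _ ≤ ∑ i, (1 / (1 - β1t (n + 1)) * (m (n + 1) i * (x (n + 1) i - y i)) +
            β1t (n + 1) / (1 - β1t (n + 1)) *
              (w i (n + 1) * D ^ 2 / 2 + m n i ^ 2 / w i (n + 1) / 2)) :=
          sum_le_sum fun i _ => mul_le_of_first_moment (hβ1t _) (sub_pos.1 hb1) (hw0 _ _)
            (hm' i n) (hm_zero_of_w i n) (hdist i _ ht)
      _ ≤ ∑ i, (1 / (1 - β1t (n + 1)) * (w i (n + 1) *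
            ((x (n + 1) i - y i) ^ 2 - (x (n + 1 + 1) i - y i) ^ 2) / 2 + q i (n + 1) / 2) +
            β1t (n + 1) / (1 - β1t (n + 1)) * (w i (n + 1) * D ^ 2 / 2 + q i n / 2)) := by
          rw [sum_add_distrib, sum_add_distrib, ← mul_sum, ← mul_sum (a := 1 / _)]
          refine add_le_add (mul_le_mul_of_nonneg_left (hdescent.trans_eq ?_) (by positivity)) ?_
          · refine sum_congr rfl fun i _ => ?_
            simp only [hq, hw]
            rw [div_div_eq_mul_div (m (n + 1) i ^ 2), mul_comm (m (n + 1) i ^ 2)]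
          · refine sum_le_sum fun i _ => ?_
            have := hβ1t (n + 1)
            have := hqprev i n
            gcongr
      _ ≤ _ := sum_le_sum fun i _ => reweighted_step_le (hβ1t _) (hβ1t' _) hβ₁' (hw0 _ _)
            (hdist i _ ht) (sq_nonneg _) (sq_nonneg _) (hq0 _ _) (hq0 _ _)
  have hqsum : ∀ i, ∑ t ∈ Icc 1 T, q i t ≤
      α * √(1 + Real.log T) / ((1 - γ) * √(1 - β₂)) * √(∑ t ∈ Icc 1 T, g t i ^ 2) := by
    intro i
    have hqu : ∀ t, q i t ≤ α / √(1 - β₂) * (u i t / √t) := fun t => by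
      have hrhs : 0 ≤ α / √(1 - β₂) * (u i t / √t) := by have := hu0 i t; positivity
      rcases (Real.sqrt_nonneg (vhat t i)).eq_or_lt with h | h
      · simpa [hq, hw, ← h] using hrhs
      · calc q i t = α / √t * (m t i ^ 2 / √(vhat t i)) := by
              simp only [hq, hw]; rw [div_div_eq_mul_div]; ring
          _ ≤ α / √t * (u i t / √(1 - β₂)) := by
              refine mul_le_mul_of_nonneg_left ?_ (by positivity)
              rw [div_le_div_iff₀ h hσ]
              exact hmoment i t
          _ = _ := by ring
    have hsum := sum_discountedSum_div_sqrt_le hγ0 (h := fun t => |g t i|)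
      (fun _ => abs_nonneg _) T
    have hcs := sum_abs_div_sqrt_le (fun t => g t i) T
    have hlast : 0 ≤ γ * (u i T / √T) := by have := hu0 i T; positivity
    have husum : ∑ t ∈ Icc 1 T, u i t / √t ≤
        √(1 + Real.log T) * √(∑ t ∈ Icc 1 T, g t i ^ 2) / (1 - γ) := by
      rw [le_div_iff₀ h1γ]
      simp only [hu] at hlast ⊢
      linarith
    calc ∑ t ∈ Icc 1 T, q i t ≤ α / √(1 - β₂) * ∑ t ∈ Icc 1 T, u i t / √t := by
          rw [mul_sum]; exact sum_le_sum fun t _ => hqu t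
      _ ≤ α / √(1 - β₂) * (√(1 + Real.log T) * √(∑ t ∈ Icc 1 T, g t i ^ 2) / (1 - γ)) := by
          gcongr
      _ = _ := by field_simp
  have hqshift : ∀ i, ∑ t ∈ Icc 1 T, q i (t - 1) ≤ ∑ t ∈ Icc 1 T, q i t := by
    intro i
    have hshift : ∀ n, ∑ t ∈ Icc 1 n, q i (t - 1) + q i n = ∑ t ∈ Icc 1 n, q i t := by
      intro n
      induction n with
      | zero => simp [hq, hm0]
      | succ n ih => rw [sum_Icc_succ_top (by omega), sum_Icc_succ_top (by omega), ← ih]; simp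
    linarith [hshift T, hq0 i T]
  have htel : ∀ i, ∑ t ∈ Icc 1 T, w i t * ((x t i - y i) ^ 2 - (x (t + 1) i - y i) ^ 2) ≤
      w i T * D ^ 2 := fun i =>
    (sum_mul_sub_succ_le (hw_mono i) (by simp [hw]) T (hdist i)).trans
      (mul_le_mul_of_nonneg_left (sub_le_self _ (sq_nonneg _)) (hw0 i T))
  have hcoord : ∀ i, ∑ t ∈ Icc 1 T,
      (w i t * ((x t i - y i) ^ 2 - (x (t + 1) i - y i) ^ 2) / 2 +
        D ^ 2 / (1 - β₁) * (β1t t * w i t) + (q i t + q i (t - 1)) / (2 * (1 - β₁))) ≤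
      D ^ 2 * √T / (α * (1 - β₁)) * √(vhat T i) +
        D ^ 2 / (1 - β₁) ^ 2 * ∑ t ∈ Icc 1 T, β1t t * √(vhat t i) / (α / √t) +
        α * √(1 + Real.log T) / ((1 - β₁) ^ 2 * (1 - γ) * √(1 - β₂)) *
          √(∑ t ∈ Icc 1 T, g t i ^ 2) := by
    intro i
    have hlog : 0 ≤ Real.log T := Real.log_natCast_nonneg T
    have hinv : 1 ≤ 1 / (1 - β₁) := (one_le_div h1β₁).2 (by linarith)
    simp only [sum_add_distrib, ← sum_div, ← mul_sum]
    refine add_le_add_three ?_ ?_ ?_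
    · have hwT : D ^ 2 * √T / (α * (1 - β₁)) * √(vhat T i) = 1 / (1 - β₁) * (w i T * D ^ 2) := by
        simp only [hw]; rw [div_div_eq_mul_div]; field_simp
      have hnn : 0 ≤ w i T * D ^ 2 := mul_nonneg (hw0 i T) (sq_nonneg D)
      rw [hwT]
      linarith [htel i, mul_le_mul_of_nonneg_right hinv hnn]
    · simp only [hw, mul_div_assoc]
      refine mul_le_mul_of_nonneg_right ?_
        (sum_nonneg fun t _ => mul_nonneg (hβ1t t) (hw0 i t))
      rw [← mul_one_div, ← mul_one_div (D ^ 2) ((1 - β₁) ^ 2)]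
      refine mul_le_mul_of_nonneg_left (one_div_le_one_div_of_le (by positivity) ?_)
        (sq_nonneg D)
      nlinarith
    · set K := α * √(1 + Real.log T) / ((1 - γ) * √(1 - β₂)) * √(∑ t ∈ Icc 1 T, g t i ^ 2)
        with hK
      have hK0 : 0 ≤ K := by positivity
      have hrhs : α * √(1 + Real.log T) / ((1 - β₁) ^ 2 * (1 - γ) * √(1 - β₂)) *
          √(∑ t ∈ Icc 1 T, g t i ^ 2) = K / (1 - β₁) / (1 - β₁) := by
        rw [hK]; field_simp
      rw [hrhs]
      have hKdiv : K / (1 - β₁) ≤ K / (1 - β₁) / (1 - β₁) :=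
        le_div_self (by positivity) h1β₁ (by linarith)
      refine le_trans ?_ hKdiv
      rw [div_le_div_iff₀ (by positivity) h1β₁]
      nlinarith [hqsum i, hqshift i]
  calc ∑ t ∈ Icc 1 T, (f t (x t) - f t y) ≤ _ := sum_le_sum hstep
    _ = _ := sum_comm
    _ ≤ _ := sum_le_sum fun i _ => hcoord i
    _ = _ := by
      rw [sum_add_distrib, sum_add_distrib, ← mul_sum, ← mul_sum, ← mul_sum, sum_comm]
end
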